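/- arXiv:2411.03259 — 2 statements merged into one kernel-verified Lean document; each statement's English description precedes it below -/
import Mathlib

section
/- Let A be a unital C*-algebra over ℂ, let d, d' ≥ 1, and let π : A → Matrix (Fin d) (Fin d) ℂ and π' : A → Matrix (Fin d') (Fin d') ℂ be surjective unital star-algebra homomorphisms. Then tr_d ∘ π = tr_{d'} ∘ π' (as functionals on A) if and only if d = d' and π and π' are unitarily equivalent, i.e. there exists a unitary matrix U ∈ Matrix (Fin d) (Fin d) ℂ such that π'(a) = U · π(a) · U* for all a ∈ A. -/
open Matrix

/-- Two surjective star-algebra homomorphisms with the same kernel differ by a star-algebra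
isomorphism of their codomains. -/
theorem StarAlgHom.exists_starAlgEquiv_of_surjective {R A B C : Type*} [CommRing R]
    [Ring A] [Algebra R A] [StarRing A] [Ring B] [Algebra R B] [StarRing B]
    [Ring C] [Algebra R C] [StarRing C] (f : A →⋆ₐ[R] B) (g : A →⋆ₐ[R] C)
    (hf : Function.Surjective f) (hg : Function.Surjective g)
    (hker : ∀ a, f a = 0 ↔ g a = 0) :
    ∃ e : B ≃⋆ₐ[R] C, ∀ a, e (f a) = g a := by
  have heq : ∀ a b, f a = f b ↔ g a = g b := fun a b ↦ by
    rw [← sub_eq_zero, ← map_sub, hker, map_sub, sub_eq_zero]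
  let s := Function.surjInv hf
  have hs : ∀ a, g (s (f a)) = g a := fun a ↦ (heq _ _).1 (Function.surjInv_eq hf _)
  let F : B →⋆ₐ[R] C :=
    { toFun := fun b ↦ g (s b)
      map_one' := by rw [← map_one f, hs, map_one]
      map_zero' := by rw [← map_zero f, hs, map_zero]
      map_mul' := hf.forall₂.2 fun a b ↦ by simp only [← map_mul, hs]
      map_add' := hf.forall₂.2 fun a b ↦ by simp only [← map_add, hs]
      commutes' := fun r ↦ by rw [← AlgHomClass.commutes f r, hs, AlgHomClass.commutes g r]
      map_star' := hf.forall.2 fun a ↦ by simp only [← map_star, hs] }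
  have hF : ∀ a, F (f a) = g a := hs
  have hbij : Function.Bijective F := by
    refine ⟨hf.forall₂.2 fun a b hab ↦ ?_, fun c ↦ ?_⟩
    · rwa [heq, ← hF, ← hF]
    · obtain ⟨a, rfl⟩ := hg c
      exact ⟨f a, hF a⟩
  exact ⟨StarAlgEquiv.ofBijective F hbij, hF⟩

/-- Every star-automorphism of a full matrix algebra is conjugation by a unitary matrix. -/
theorem Matrix.exists_unitary_starAlgEquiv_eq_conj {𝕜 n : Type*} [RCLike 𝕜] [Fintype n]
    [DecidableEq n] (e : Matrix n n 𝕜 ≃⋆ₐ[𝕜] Matrix n n 𝕜) :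
    ∃ U ∈ Matrix.unitaryGroup n 𝕜, ∀ M, e M = U * M * star U := by
  let φ := Matrix.toEuclideanCLM (n := n) (𝕜 := 𝕜)
  let E := (φ.symm.trans e).trans φ
  obtain ⟨V, hV⟩ := E.eq_linearIsometryEquivConjStarAlgEquiv
    (LinearMap.continuous_of_finiteDimensional E.toAlgEquiv.toLinearMap)
  let u := Unitary.linearIsometryEquiv.symm V
  refine ⟨φ.symm u, Unitary.map_mem φ.symm u.2, fun M ↦ ?_⟩
  have h : E (φ M) = (u : EuclideanSpace 𝕜 n →L[𝕜] EuclideanSpace 𝕜 n) * φ M *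
      star (u : EuclideanSpace 𝕜 n →L[𝕜] EuclideanSpace 𝕜 n) := by
    rw [hV, Unitary.coe_symm_linearIsometryEquiv_apply, LinearIsometryEquiv.star_eq_symm]
    rfl
  have h' : E (φ M) = φ (e M) := by simp [E]
  rw [← φ.symm_apply_apply (e M), ← h', h, map_mul, map_mul, φ.symm_apply_apply]
  exact congrArg _ (φ.symm.map_star' _)

/-- Star-algebra homomorphisms into matrix algebras whose traces agree up to nonzero factors
have the same kernel. -/
theorem StarAlgHom.apply_eq_zero_iff_of_mul_trace_eq {A m n : Type*} [Semiring A]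
    [Algebra ℂ A] [StarRing A] [Fintype m] [DecidableEq m] [Fintype n] [DecidableEq n]
    {c c' : ℂ} (hc : c ≠ 0) (hc' : c' ≠ 0)
    (f : A →⋆ₐ[ℂ] Matrix m m ℂ) (g : A →⋆ₐ[ℂ] Matrix n n ℂ)
    (h : ∀ a, c * (f a).trace = c' * (g a).trace) (a : A) : f a = 0 ↔ g a = 0 := by
  open scoped ComplexOrder in
  have key := h (star a * a)
  simp only [map_mul, map_star, star_eq_conjTranspose] at key
  rw [← trace_conjTranspose_mul_self_eq_zero_iff, ← trace_conjTranspose_mul_self_eq_zero_iff,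
    ← mul_eq_zero_iff_left hc, key, mul_eq_zero_iff_left hc']


/-- Two finite-dimensional irreducible star-representations (surjective
unital star-algebra homomorphisms onto full matrix algebras) of a unital C*-algebra induce
the same normalized-trace functional iff they have the same dimension and are unitarily
equivalent. -/
theorem stmt_11 {A : Type*} [CStarAlgebra A] (d d' : ℕ) (hd : 1 ≤ d) (hd' : 1 ≤ d')
    (π : A →⋆ₐ[ℂ] Matrix (Fin d) (Fin d) ℂ)
    (π' : A →⋆ₐ[ℂ] Matrix (Fin d') (Fin d') ℂ)
    (hπ : Function.Surjective π) (hπ' : Function.Surjective π') :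
    (∀ a : A, (1 / (d : ℂ)) * Matrix.trace (π a) = (1 / (d' : ℂ)) * Matrix.trace (π' a)) ↔
      ∃ h : d' = d, ∃ U ∈ Matrix.unitaryGroup (Fin d) ℂ,
        ∀ a : A, Matrix.reindex (finCongr h) (finCongr h) (π' a) = U * π a * star U := by
  have hd0 : (d : ℂ) ≠ 0 := by exact_mod_cast (by omega : d ≠ 0)
  have hd0' : (d' : ℂ) ≠ 0 := by exact_mod_cast (by omega : d' ≠ 0)
  constructor
  · intro h
    obtain ⟨e, he⟩ := StarAlgHom.exists_starAlgEquiv_of_surjective π' π hπ' hπ fun a ↦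
      (StarAlgHom.apply_eq_zero_iff_of_mul_trace_eq (one_div_ne_zero hd0)
        (one_div_ne_zero hd0') π π' h a).symm
    have hdim : d' = d := by
      have := e.toAlgEquiv.toLinearEquiv.finrank_eq
      exact Nat.mul_self_inj.1 (by simpa [Module.finrank_matrix] using this)
    subst hdim
    obtain ⟨U, hU, hconj⟩ := Matrix.exists_unitary_starAlgEquiv_eq_conj e.symm
    refine ⟨rfl, U, hU, fun a ↦ ?_⟩
    rw [← hconj, ← he, StarAlgEquiv.symm_apply_apply]
    rfl
  · rintro ⟨rfl, U, hU, hconj⟩ a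
    have h : π' a = U * π a * star U := hconj a
    rw [h, Matrix.trace_mul_cycle, Unitary.star_mul_self_of_mem hU, one_mul]
end

section
/- Let d ≥ 1 and let ρ ∈ Matrix (Fin d) (Fin d) ℂ be positive semidefinite with trace ρ = 1, with positive semidefinite square root √ρ. Let W₁, W₂ ∈ Matrix (Fin d) (Fin d) ℂ satisfy ‖W₁‖_op ≤ 1 and ‖W₂‖_op ≤ 1, and suppose ‖W₁·√ρ − √ρ·W₁‖_F ≤ δ₁ and ‖W₂·√ρ − √ρ·W₂‖_F ≤ δ₂ for some δ₁, δ₂ ≥ 0. Then |trace(W₁·W₂·ρ) − trace(W₂·W₁·ρ)| ≤ δ₁ + δ₂. -/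
open scoped ComplexOrder

/-- The Frobenius norm `‖T‖_F = √(trace (T* T))` of a complex matrix. -/
noncomputable def frobNorm {d : ℕ} (T : Matrix (Fin d) (Fin d) ℂ) : ℝ :=
  Real.sqrt ((Matrix.trace (T.conjTranspose * T)).re)

/-- The `ℓ²`-operator norm of a complex matrix, i.e. the norm of the induced operator on
`EuclideanSpace ℂ (Fin d)`. -/
noncomputable def opNorm {d : ℕ} (T : Matrix (Fin d) (Fin d) ℂ) : ℝ :=
  ‖Matrix.toEuclideanCLM (𝕜 := ℂ) (n := Fin d) T‖

/-- The trace pairing of two matrices is the sum of the inner products of their columns. -/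
theorem trace_conjTranspose_mul_eq_sum_inner {d : ℕ} (A B : Matrix (Fin d) (Fin d) ℂ) :
    Matrix.trace (A.conjTranspose * B) =
      ∑ j, inner ℂ (WithLp.toLp 2 (A.col j)) (WithLp.toLp 2 (B.col j)) := by
  simp [Matrix.trace, Matrix.mul_apply, PiLp.inner_apply, mul_comm]

theorem frobNorm_eq_sqrt_sum {d : ℕ} (T : Matrix (Fin d) (Fin d) ℂ) :
    frobNorm T = Real.sqrt (∑ j, ‖WithLp.toLp 2 (T.col j)‖ ^ 2) := by
  rw [frobNorm, trace_conjTranspose_mul_eq_sum_inner, Complex.re_sum]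
  congr 1
  refine Finset.sum_congr rfl fun j _ => ?_
  rw [inner_self_eq_norm_sq_to_K]
  norm_cast

/-- The Cauchy–Schwarz inequality for the Frobenius inner product. -/
theorem norm_trace_conjTranspose_mul_le {d : ℕ} (A B : Matrix (Fin d) (Fin d) ℂ) :
    ‖Matrix.trace (A.conjTranspose * B)‖ ≤ frobNorm A * frobNorm B := by
  rw [trace_conjTranspose_mul_eq_sum_inner, frobNorm_eq_sqrt_sum, frobNorm_eq_sqrt_sum]
  refine (norm_sum_le _ _).trans ((Finset.sum_le_sum fun j _ => norm_inner_le_norm _ _).trans ?_)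
  exact Real.sum_mul_le_sqrt_mul_sqrt _ _ _

theorem frobNorm_mul_le_of_opNorm_le_one {d : ℕ} {W : Matrix (Fin d) (Fin d) ℂ}
    (hW : opNorm W ≤ 1) (C : Matrix (Fin d) (Fin d) ℂ) : frobNorm (W * C) ≤ frobNorm C := by
  rw [frobNorm_eq_sqrt_sum, frobNorm_eq_sqrt_sum]
  gcongr with j
  have h : WithLp.toLp 2 ((W * C).col j) =
      Matrix.toEuclideanCLM (𝕜 := ℂ) (n := Fin d) W (WithLp.toLp 2 (C.col j)) := by
    ext i
    simp [Matrix.mul_apply, Matrix.mulVec, dotProduct]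
  rw [h]
  exact ContinuousLinearMap.le_of_opNorm_le _ hW _ |>.trans_eq (one_mul _)

/-- If `ρ` is a density matrix with positive semidefinite square root
`√ρ`, and `W₁, W₂` are contractions approximately commuting with `√ρ` in Frobenius norm,
then `|tr(W₁ W₂ ρ) − tr(W₂ W₁ ρ)| ≤ δ₁ + δ₂`. -/
theorem stmt_15 (d : ℕ) (hd : 1 ≤ d) (ρ sqrtρ : Matrix (Fin d) (Fin d) ℂ)
    (hρ : ρ.PosSemidef) (hρtr : Matrix.trace ρ = 1)
    (hs : sqrtρ.PosSemidef) (hss : sqrtρ * sqrtρ = ρ)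
    (W₁ W₂ : Matrix (Fin d) (Fin d) ℂ) (δ₁ δ₂ : ℝ) (hδ₁ : 0 ≤ δ₁) (hδ₂ : 0 ≤ δ₂)
    (hW₁ : opNorm W₁ ≤ 1) (hW₂ : opNorm W₂ ≤ 1)
    (hc₁ : frobNorm (W₁ * sqrtρ - sqrtρ * W₁) ≤ δ₁)
    (hc₂ : frobNorm (W₂ * sqrtρ - sqrtρ * W₂) ≤ δ₂) :
    ‖Matrix.trace (W₁ * W₂ * ρ) - Matrix.trace (W₂ * W₁ * ρ)‖ ≤ δ₁ + δ₂ := by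
  have hfs : frobNorm sqrtρ = 1 := by
    rw [frobNorm, hs.isHermitian.eq, hss, hρtr, Complex.one_re, Real.sqrt_one]
  have bound : ∀ {W C : Matrix (Fin d) (Fin d) ℂ} {δ : ℝ}, opNorm W ≤ 1 → frobNorm C ≤ δ →
      ‖Matrix.trace (sqrtρ * (W * C))‖ ≤ δ := by
    intro W C δ hW hC
    have h := norm_trace_conjTranspose_mul_le sqrtρ (W * C)
    rw [hs.isHermitian.eq, hfs, one_mul] at h
    exact h.trans ((frobNorm_mul_le_of_opNorm_le_one hW C).trans hC)
  have expand : ∀ V W : Matrix (Fin d) (Fin d) ℂ, Matrix.trace (V * W * ρ) =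
      Matrix.trace (sqrtρ * (V * (W * sqrtρ - sqrtρ * W))) +
        Matrix.trace (sqrtρ * V * (sqrtρ * W)) := by
    intro V W
    rw [← hss, ← mul_assoc, Matrix.trace_mul_comm, ← Matrix.trace_add]
    congr 1
    noncomm_ring
  rw [expand W₁ W₂, expand W₂ W₁, Matrix.trace_mul_comm (sqrtρ * W₂), add_sub_add_right_eq_sub]
  refine (norm_sub_le _ _).trans ?_
  rw [add_comm δ₁]
  exact add_le_add (bound hW₁ hc₂) (bound hW₂ hc₁)
end
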